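/- Let n ≥ 2, let u be a convex viscosity solution of σ₂(D²u) = 1 on the unit ball B₁ ⊂ ℝⁿ, and let ℓ be an affine function with ℓ ≤ u on B₁. Then the convex set E := {x ∈ B₁ : u(x) = ℓ(x)} has affine dimension at most n − 2; in particular, E does not contain a relatively open subset of any hyperplane. -/

import Mathlib

open Metric MeasureTheory

/-- The second elementary symmetric function of the eigenvalues of a symmetric
matrix, `σ₂(M) = ((tr M)² − ‖M‖_F²)/2`. -/
noncomputable def sigma2 {ι : Type*} [Fintype ι] (M : Matrix ι ι ℝ) : ℝ :=
  (M.trace ^ 2 - ∑ i, ∑ j, M i j ^ 2) / 2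

/-- The Frobenius norm of a matrix. -/
noncomputable def frobNorm {ι : Type*} [Fintype ι] (M : Matrix ι ι ℝ) : ℝ :=
  Real.sqrt (∑ i, ∑ j, M i j ^ 2)

/-- The Hessian matrix `D²u(x)` of a function on Euclidean space. -/
noncomputable def hess {ι : Type*} [Fintype ι] [DecidableEq ι]
    (u : EuclideanSpace ℝ ι → ℝ) (x : EuclideanSpace ℝ ι) : Matrix ι ι ℝ :=
  fun i j =>
    fderiv ℝ (fun y => fderiv ℝ u y (EuclideanSpace.single j (1 : ℝ))) x
      (EuclideanSpace.single i (1 : ℝ))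

/-- The Laplacian `Δu(x)`, the trace of the Hessian. -/
noncomputable def lap {ι : Type*} [Fintype ι] [DecidableEq ι]
    (u : EuclideanSpace ℝ ι → ℝ) (x : EuclideanSpace ℝ ι) : ℝ :=
  (hess u x).trace

/-- A symmetric matrix is 2-convex if `tr M ≥ 0` and `σ₂(M) ≥ 0`. -/
def TwoConvex {ι : Type*} [Fintype ι] (M : Matrix ι ι ℝ) : Prop :=
  0 ≤ M.trace ∧ 0 ≤ sigma2 M

/-- `u` is a viscosity subsolution of `σ₂(D²u) = 1` on `B₁`. -/
def ViscSubsol (n : ℕ) (u : EuclideanSpace ℝ (Fin n) → ℝ) : Prop :=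
  ∀ x₀ ∈ ball (0 : EuclideanSpace ℝ (Fin n)) 1,
    ∀ (φ : EuclideanSpace ℝ (Fin n) → ℝ) (ε : ℝ), 0 < ε →
      ball x₀ ε ⊆ ball 0 1 →
      ContDiffOn ℝ 2 φ (ball x₀ ε) →
      (∀ y ∈ ball x₀ ε, u y ≤ φ y) → φ x₀ = u x₀ →
      1 ≤ sigma2 (hess φ x₀)

/-- `u` is a viscosity supersolution of `σ₂(D²u) = 1` on `B₁`: 2-convex `C²` test
functions touching from below have `σ₂(D²φ) ≤ 1` at the touching point. -/
def ViscSupersol (n : ℕ) (u : EuclideanSpace ℝ (Fin n) → ℝ) : Prop :=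
  ∀ x₀ ∈ ball (0 : EuclideanSpace ℝ (Fin n)) 1,
    ∀ (φ : EuclideanSpace ℝ (Fin n) → ℝ) (ε : ℝ), 0 < ε →
      ball x₀ ε ⊆ ball 0 1 →
      ContDiffOn ℝ 2 φ (ball x₀ ε) →
      (∀ y ∈ ball x₀ ε, TwoConvex (hess φ y)) →
      (∀ y ∈ ball x₀ ε, φ y ≤ u y) → φ x₀ = u x₀ →
      sigma2 (hess φ x₀) ≤ 1


open scoped RealInnerProductSpace in
/-- Hessian of a quadratic polynomial. -/
lemma hess_quad {n : ℕ} (p ν : EuclideanSpace ℝ (Fin n)) (A B d : ℝ)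
    (L : EuclideanSpace ℝ (Fin n) →L[ℝ] ℝ) (x : EuclideanSpace ℝ (Fin n)) (i j : Fin n) :
    hess (fun y => A * ‖y - p‖ ^ 2 + B * ⟪ν, y - p⟫ ^ 2 + L y + d) x i j =
      2 * A * (if i = j then 1 else 0) + 2 * B * (ν i * ν j) := by
  have h1 : ∀ y v, fderiv ℝ (fun y => A * ‖y - p‖ ^ 2 + B * ⟪ν, y - p⟫ ^ 2 + L y + d) y v =
      2 * A * ⟪v, y - p⟫ + 2 * B * ⟪ν, v⟫ * ⟪ν, y - p⟫ + L v := by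
    intro y v
    have hid : HasFDerivAt (fun y : EuclideanSpace ℝ (Fin n) => y - p)
        (ContinuousLinearMap.id ℝ _) y := (hasFDerivAt_id y).sub_const p
    have ha := (hid.norm_sq).const_mul A
    have hs : HasFDerivAt (fun y : EuclideanSpace ℝ (Fin n) => ⟪ν, y - p⟫)
        ((innerSL ℝ ν).comp (ContinuousLinearMap.id ℝ _)) y :=
      (innerSL ℝ ν).hasFDerivAt.comp y hid
    have hb := (hs.pow 2).const_mul B
    have := ((ha.add hb).add L.hasFDerivAt).add_const d
    have h2 := this.fderiv
    refine (congrArg (fun T => T v) h2).trans ?_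
    rw [real_inner_comm (y - p) v]
    simp [inner_sub_left]
    ring
  unfold hess
  simp_rw [h1]
  have hid : HasFDerivAt (fun y : EuclideanSpace ℝ (Fin n) => y - p)
        (ContinuousLinearMap.id ℝ _) x := (hasFDerivAt_id x).sub_const p
  have hs : ∀ ν, HasFDerivAt (fun y : EuclideanSpace ℝ (Fin n) => ⟪ν, y - p⟫)
        ((innerSL ℝ ν).comp (ContinuousLinearMap.id ℝ _)) x := fun ν =>
      (innerSL ℝ ν).hasFDerivAt.comp x hid
  have := (((hs (EuclideanSpace.single j (1 : ℝ))).const_mul (2 * A)).add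
    ((hs ν).const_mul (2 * B * ⟪ν, EuclideanSpace.single j (1 : ℝ)⟫))).add_const
      (L (EuclideanSpace.single j (1 : ℝ)))
  refine (congrArg (fun T => T (EuclideanSpace.single i (1 : ℝ))) this.fderiv).trans ?_
  simp [EuclideanSpace.inner_single_right, eq_comm]
  ring

lemma sigma2_quad {n : ℕ} (ν : EuclideanSpace ℝ (Fin n)) (hν : ‖ν‖ = 1) (A B : ℝ)
    (M : Matrix (Fin n) (Fin n) ℝ)
    (hM : ∀ i j, M i j = 2 * A * (if i = j then 1 else 0) + 2 * B * (ν i * ν j)) :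
    sigma2 M = ((2 * A * n + 2 * B) ^ 2 - (4 * A ^ 2 * n + 8 * A * B + 4 * B ^ 2)) / 2 := by
  have hs : ∑ i, ν i ^ 2 = 1 := by
    have := EuclideanSpace.real_norm_sq_eq ν
    rw [hν] at this
    linarith
  have ht : M.trace = 2 * A * n + 2 * B := by
    simp only [Matrix.trace, Matrix.diag, hM]
    simp only [if_true, Finset.sum_add_distrib, ← Finset.mul_sum, ← pow_two, hs]
    simp
  have hf : ∑ i, ∑ j, M i j ^ 2 = 4 * A ^ 2 * n + 8 * A * B + 4 * B ^ 2 := by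
    have : ∀ i j, M i j ^ 2 = (if i = j then 4 * A ^ 2 + 8 * A * B * ν i ^ 2 else 0)
        + 4 * B ^ 2 * (ν i ^ 2 * ν j ^ 2) := by
      intro i j
      rw [hM]
      split_ifs with h
      · subst h; ring
      · ring
    simp_rw [this, Finset.sum_add_distrib, ← Finset.mul_sum, hs]
    simp [Finset.sum_add_distrib, ← Finset.mul_sum, hs]
    ring
  rw [sigma2, ht, hf]

lemma barrier_numeric (n ρ h ε A b : ℝ) (hn1 : 1 ≤ n) (hρ0 : 0 < ρ) (hρ1 : ρ ≤ 1 / 4)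
    (hh : 0 < h) (hh1 : h ≤ 1) (hε : ε = ρ ^ 2 / (8 * n)) (hA : A = 2 * ε * h / ρ ^ 2)
    (hb : b = 2 * ε / h) :
    ((2 * A * n + 2 * (b - A)) ^ 2 - (4 * A ^ 2 * n + 8 * A * (b - A) + 4 * (b - A) ^ 2)) / 2
      < 1 := by
  have hn0 : 0 < n := by linarith
  have hε0 : 0 < ε := by rw [hε]; positivity
  have hA0 : 0 < A := by rw [hA]; positivity
  have hb0 : 0 < b := by rw [hb]; positivity
  have hAn : A * n = h / 4 := by
    rw [hA, hε]; field_simp; norm_num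
  have hAbn : A * n * b = ε / 2 := by
    rw [hAn, hb]; field_simp; norm_num
  have hε2 : ε ≤ 1 / 16 := by
    rw [hε, div_le_iff₀ (by positivity)]
    nlinarith
  have hAbpos : 0 < A * b := by positivity
  have hsq : (A * n) ^ 2 ≤ 1 / 16 := by
    rw [hAn]; nlinarith
  have hA2 : A ^ 2 ≤ (A * n) * A := by
    have : A ≤ A * n := le_mul_of_one_le_right hA0.le hn1
    nlinarith
  have hA3 : 0 < A ^ 2 := by positivity
  nlinarith

open scoped RealInnerProductSpace in
lemma exists_flat_disc {n : ℕ} (hn : 2 ≤ n) (E : Set (EuclideanSpace ℝ (Fin n)))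
    (hE : Convex ℝ E) (hsub : E ⊆ ball 0 1)
    (hdim : ¬ Module.finrank ℝ (vectorSpan ℝ E) ≤ n - 2) :
    ∃ (p ν : EuclideanSpace ℝ (Fin n)) (R : ℝ), 0 < R ∧ R ≤ 1 ∧ ‖ν‖ = 1 ∧
      ball p R ⊆ ball 0 1 ∧ ∀ w, ⟪ν, w⟫ = 0 → ‖w‖ < R → p + w ∈ E := by
  have hne : E.Nonempty := by
    by_contra h
    rw [Set.not_nonempty_iff_eq_empty] at h
    subst h
    exact hdim (by rw [vectorSpan_empty, finrank_bot]; omega)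
  obtain ⟨p, hp⟩ := hne.intrinsicInterior hE
  have hpE : p ∈ E := intrinsicInterior_subset hp
  rw [mem_intrinsicInterior] at hp
  obtain ⟨y, hy, hyp⟩ := hp
  rw [mem_interior_iff_mem_nhds, Metric.mem_nhds_iff] at hy
  obtain ⟨r, hr, hball⟩ := hy
  obtain ⟨r', hr', hball'⟩ := Metric.isOpen_iff.1 isOpen_ball p (hsub hpE)
  have hν : ∃ ν : EuclideanSpace ℝ (Fin n), ‖ν‖ = 1 ∧
      ∀ w, ⟪ν, w⟫ = 0 → w ∈ vectorSpan ℝ E := by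
    set D := vectorSpan ℝ E with hD
    have hfr := D.finrank_add_finrank_orthogonal
    rw [finrank_euclideanSpace_fin] at hfr
    by_cases hbot : Dᗮ = ⊥
    · have : D = ⊤ := by rwa [Submodule.orthogonal_eq_bot_iff] at hbot
      refine ⟨EuclideanSpace.single ⟨0, by omega⟩ 1, by simp, fun w _ => by rw [this]; trivial⟩
    · obtain ⟨v, hv, hv0⟩ := Submodule.exists_mem_ne_zero_of_ne_bot hbot
      have hle : Module.finrank ℝ Dᗮ ≤ 1 := by omega
      refine ⟨‖v‖⁻¹ • v, norm_smul_inv_norm hv0, fun w hw => ?_⟩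
      have hspan : Submodule.span ℝ {v} = Dᗮ := by
        apply Submodule.eq_of_le_of_finrank_le
        · rwa [Submodule.span_singleton_le_iff_mem]
        · rw [finrank_span_singleton hv0]; exact hle
      rw [← Submodule.orthogonal_orthogonal D, ← hspan, Submodule.mem_orthogonal_singleton_iff_inner_right]
      rw [real_inner_smul_left] at hw
      have : ‖v‖⁻¹ ≠ 0 := inv_ne_zero (norm_ne_zero_iff.2 hv0)
      exact (mul_eq_zero.1 hw).resolve_left this
  obtain ⟨ν, hν1, hν2⟩ := hν
  refine ⟨p, ν, min (min r r') 1, by positivity, min_le_right _ _, hν1, ?_, ?_⟩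
  · exact (ball_subset_ball ((min_le_left _ _).trans (min_le_right _ _))).trans hball'
  · intro w hw hwR
    have hmem : p + w ∈ affineSpan ℝ E := by
      have h1 : w ∈ (affineSpan ℝ E).direction := by
        rw [direction_affineSpan]; exact hν2 w hw
      have := AffineSubspace.vadd_mem_of_mem_direction h1 (subset_affineSpan ℝ E hpE)
      rwa [vadd_eq_add, add_comm] at this
    have : (⟨p + w, hmem⟩ : affineSpan ℝ E) ∈ ball y r := by
      rw [mem_ball, Subtype.dist_eq, hyp, dist_eq_norm]
      simp only [add_sub_cancel_left]
      exact hwR.trans_le ((min_le_left _ _).trans (min_le_left _ _))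
    exact hball this

open scoped RealInnerProductSpace in
/-- Slope estimate near a flat disc. -/
lemma slope_estimate {n : ℕ} (g : EuclideanSpace ℝ (Fin n) → ℝ)
    (p ν : EuclideanSpace ℝ (Fin n)) (R : ℝ) (hR : 0 < R) (hν : ‖ν‖ = 1)
    (hg : ConvexOn ℝ (ball p R) g) (hg0 : ∀ x ∈ ball p R, 0 ≤ g x)
    (hz : ∀ w, ⟪ν, w⟫ = 0 → ‖w‖ < R → g (p + w) = 0) (ε : ℝ) (hε : 0 < ε) :
    ∃ a h : ℝ, 0 < h ∧ h ≤ R / 4 ∧ ∀ w s, ⟪ν, w⟫ = 0 → ‖w‖ ≤ R / 4 → 0 ≤ s → s ≤ h →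
      a * s ≤ g (p + w + s • ν) ∧ g (p + w + s • ν) ≤ (a + ε) * s := by
  have hin : ∀ w s, ‖w‖ ≤ R / 2 → 0 ≤ s → s ≤ R / 4 → p + w + s • ν ∈ ball p R := by
    intro w s hw hs hs'
    rw [mem_ball, dist_eq_norm]
    have : p + w + s • ν - p = w + s • ν := by abel
    rw [this]
    calc ‖w + s • ν‖ ≤ ‖w‖ + ‖s • ν‖ := norm_add_le _ _
      _ = ‖w‖ + s := by rw [norm_smul, hν, Real.norm_of_nonneg hs, mul_one]
      _ < R := by linarith
  set S : Set ℝ := (fun s => g (p + s • ν) / s) '' Set.Ioc 0 (R / 4) with hS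
  have hSne : S.Nonempty := ⟨_, R / 4, ⟨by positivity, le_rfl⟩, rfl⟩
  have hSb : BddBelow S := by
    refine ⟨0, ?_⟩
    rintro _ ⟨s, hs, rfl⟩
    have := hg0 _ (hin 0 s (by simp; positivity) hs.1.le hs.2)
    rw [add_zero] at this
    exact div_nonneg this hs.1.le
  set a := sInf S with ha
  have hlow : ∀ s, 0 ≤ s → s ≤ R / 4 → a * s ≤ g (p + s • ν) := by
    intro s hs hs'
    rcases hs.eq_or_lt with rfl | hs
    · have := hz 0 (by simp) (by simpa using hR)
      simp only [add_zero] at this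
      simp [this]
    · have : a ≤ g (p + s • ν) / s := csInf_le hSb ⟨s, ⟨hs, hs'⟩, rfl⟩
      rwa [le_div_iff₀ hs] at this
  obtain ⟨_, ⟨s₁, hs₁, rfl⟩, hlt⟩ := exists_lt_of_csInf_lt hSne (lt_add_of_pos_right a hε)
  simp only at hlt
  rw [div_lt_iff₀ hs₁.1] at hlt
  have hs1p := hs₁.1
  have hs1l := hs₁.2
  have hmem0 : ∀ w, ‖w‖ < R → p + w ∈ ball p R := by
    intro w hw
    rw [mem_ball, dist_eq_norm]; simpa using hw
  refine ⟨a, s₁ / 2, by linarith, by linarith, fun w s hw hwR hs hsh => ⟨?_, ?_⟩⟩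
  · have h1 := hg.2 (hin w s (by linarith) hs (by linarith))
      (hmem0 (-w) (by rw [norm_neg]; linarith)) (show (0 : ℝ) ≤ 1 / 2 by norm_num)
      (show (0 : ℝ) ≤ 1 / 2 by norm_num) (by norm_num)
    rw [hz (-w) (by simp [hw]) (by rw [norm_neg]; linarith)] at h1
    have e : (1 / 2 : ℝ) • (p + w + s • ν) + (1 / 2 : ℝ) • (p + -w) = p + (s / 2) • ν := by
      module
    rw [e] at h1
    have h2 := hlow (s / 2) (by linarith) (by linarith)
    simp only [smul_eq_mul] at h1
    linarith
  · have hn2 : ‖(2 : ℝ) • w‖ = 2 * ‖w‖ := by rw [norm_smul]; norm_num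
    have hA : g (p + w + (s₁ / 2) • ν) ≤ (a + ε) * (s₁ / 2) := by
      have hm := hin 0 s₁ (by simp; positivity) hs₁.1.le hs₁.2
      rw [add_zero] at hm
      have h1 := hg.2 hm
        (hmem0 ((2 : ℝ) • w) (by rw [hn2]; linarith)) (show (0 : ℝ) ≤ 1 / 2 by norm_num)
        (show (0 : ℝ) ≤ 1 / 2 by norm_num) (by norm_num)
      rw [hz ((2 : ℝ) • w) (by rw [real_inner_smul_right, hw, mul_zero]) (by rw [hn2]; linarith)]
        at h1
      have e : (1 / 2 : ℝ) • (p + s₁ • ν) + (1 / 2 : ℝ) • (p + (2 : ℝ) • w)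
          = p + w + (s₁ / 2) • ν := by
        module
      rw [e] at h1
      simp only [smul_eq_mul] at h1
      linarith
    set h := s₁ / 2 with hh
    have hhp : 0 < h := by linarith
    have h1 := hg.2 (hin w h (by linarith) hhp.le (by linarith))
      (hmem0 w (by linarith)) (show 0 ≤ s / h by positivity)
      (show 0 ≤ 1 - s / h by rw [sub_nonneg, div_le_one hhp]; exact hsh) (by ring)
    rw [hz w hw (by linarith)] at h1
    have e : (s / h) • (p + w + h • ν) + (1 - s / h) • (p + w) = p + w + s • ν := by
      have : s • ν = (s / h * h) • ν := by rw [div_mul_cancel₀ _ hhp.ne']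
      rw [this]
      module
    rw [e] at h1
    simp only [smul_eq_mul, mul_zero, add_zero] at h1
    calc _ ≤ s / h * g (p + w + h • ν) := h1
      _ ≤ s / h * ((a + ε) * h) := by gcongr
      _ = (a + ε) * s := by field_simp

set_option maxHeartbeats 1000000 in
open scoped RealInnerProductSpace in
theorem convex_contact_set_dimension (n : ℕ) (hn : 2 ≤ n)
    (u : EuclideanSpace ℝ (Fin n) → ℝ)
    (hu_cont : ContinuousOn u (ball 0 1))
    (hu_conv : ConvexOn ℝ (ball 0 1) u)
    (hu_sub : ViscSubsol n u) (hu_super : ViscSupersol n u)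
    (ℓ : EuclideanSpace ℝ (Fin n) →ᵃ[ℝ] ℝ)
    (hℓ : ∀ x ∈ ball (0 : EuclideanSpace ℝ (Fin n)) 1, ℓ x ≤ u x) :
    Module.finrank ℝ
      (vectorSpan ℝ {x ∈ ball (0 : EuclideanSpace ℝ (Fin n)) 1 | u x = ℓ x}) ≤ n - 2 := by
  by_contra hdim
  set Lc : EuclideanSpace ℝ (Fin n) →L[ℝ] ℝ := LinearMap.toContinuousLinearMap ℓ.linear with hLc
  have hdec : ∀ x, ℓ x = Lc x + ℓ 0 := by
    intro x
    have := congrFun ℓ.decomp x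
    simpa [hLc] using this
  set g : EuclideanSpace ℝ (Fin n) → ℝ := fun x => u x - ℓ x with hgdef
  have hgconv : ConvexOn ℝ (ball 0 1) g := by
    refine ⟨hu_conv.1, fun x hx y hy a b ha hb hab => ?_⟩
    have h1 := hu_conv.2 hx hy ha hb hab
    have h2 : ℓ (a • x + b • y) = a * ℓ x + b * ℓ y := by
      rw [hdec (a • x + b • y), hdec x, hdec y]
      simp only [map_add, map_smul, smul_eq_mul]
      linear_combination (-ℓ 0) * hab
    simp only [hgdef, h2, smul_eq_mul] at h1 ⊢
    linarith
  have hgcont : ContinuousOn g (ball 0 1) := by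
    have : Continuous (fun x => ℓ x) := by
      have e : (fun x => ℓ x) = fun x => Lc x + ℓ 0 := funext hdec
      rw [e]; fun_prop
    exact hu_cont.sub this.continuousOn
  have hE : Convex ℝ {x ∈ ball (0 : EuclideanSpace ℝ (Fin n)) 1 | u x = ℓ x} := by
    have := hgconv.convex_le 0
    convert this using 1
    ext x
    simp only [Set.mem_ofPred_eq, hgdef]
    constructor
    · rintro ⟨h1, h2⟩; exact ⟨h1, by linarith⟩
    · rintro ⟨h1, h2⟩; exact ⟨h1, le_antisymm (by linarith) (hℓ x h1)⟩
  obtain ⟨p, ν, R, hR, hR1, hν, hball, hflat⟩ :=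
    exists_flat_disc hn _ hE (fun x hx => hx.1) hdim
  have hn0 : (0 : ℝ) < n := by positivity
  have hn1 : (1 : ℝ) ≤ n := by exact_mod_cast (by omega : 1 ≤ n)
  set ρ := R / 4 with hρ
  have hρ0 : 0 < ρ := by positivity
  set ε := ρ ^ 2 / (8 * n) with hεdef
  have hε : 0 < ε := by positivity
  obtain ⟨a, h, hh, hhR, hest⟩ := slope_estimate g p ν R hR hν
    (hgconv.subset hball (convex_ball _ _)) (fun x hx => sub_nonneg.2 (hℓ x (hball hx)))
    (fun w hw hwR => sub_eq_zero.2 (hflat w hw hwR).2) ε hε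
  set s : EuclideanSpace ℝ (Fin n) → ℝ := fun x => ⟪ν, x - p⟫ with hs
  set q : EuclideanSpace ℝ (Fin n) → ℝ := fun x => ‖x - p‖ ^ 2 - s x ^ 2 with hq
  have hscont : Continuous s := by fun_prop
  have hqcont : Continuous q := by fun_prop
  set K : Set (EuclideanSpace ℝ (Fin n)) := {x | q x ≤ ρ ^ 2 ∧ 0 ≤ s x ∧ s x ≤ h} with hK
  -- estimates on K
  have hKest : ∀ x ∈ K, a * s x ≤ g x ∧ g x ≤ (a + ε) * s x := by
    rintro x ⟨h1, h2, h3⟩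
    have hνν : ⟪ν, ν⟫ = 1 := by rw [real_inner_self_eq_norm_sq, hν]; norm_num
    have horth : ⟪ν, x - p - s x • ν⟫ = 0 := by
      rw [inner_sub_right, real_inner_smul_right, hνν]
      simp [hs]
    have hnorm : ‖x - p - s x • ν‖ ^ 2 = q x := by
      rw [norm_sub_sq_real, norm_smul, real_inner_smul_right, real_inner_comm, hν]
      simp only [hq, hs, mul_one, Real.norm_eq_abs, sq_abs]
      ring
    have hle : ‖x - p - s x • ν‖ ≤ ρ := by
      apply le_of_sq_le_sq _ hρ0.le
      rw [hnorm]; exact h1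
    have := hest _ (s x) horth hle h2 h3
    have e : p + (x - p - s x • ν) + s x • ν = x := by abel
    rwa [e] at this
  have hKsub : K ⊆ closedBall p (R / 2) := by
    rintro x ⟨h1, h2, h3⟩
    rw [mem_closedBall, dist_eq_norm]
    apply le_of_sq_le_sq _ (by positivity)
    have h4 : s x ^ 2 ≤ ρ ^ 2 := by gcongr; linarith
    simp only [hq] at h1
    have : (R / 2) ^ 2 = 4 * ρ ^ 2 := by rw [hρ]; ring
    nlinarith [sq_nonneg ρ]
  have hKball : K ⊆ ball 0 1 := hKsub.trans
    ((closedBall_subset_ball (by linarith)).trans hball)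
  have hKclosed : IsClosed K :=
    (isClosed_le hqcont continuous_const).inter
      ((isClosed_le continuous_const hscont).inter (isClosed_le hscont continuous_const))
  have hKcomp : IsCompact K := (isCompact_closedBall p (R / 2)).of_isClosed_subset hKclosed hKsub
  set A := 2 * ε * h / ρ ^ 2 with hA
  set b := 2 * ε / h with hb
  have hAρ : A * ρ ^ 2 = 2 * ε * h := by rw [hA]; field_simp
  have hbh : b * h = 2 * ε := by rw [hb]; field_simp
  have hA0 : 0 < A := by positivity
  have hb0 : 0 < b := by positivity
  set Φ : EuclideanSpace ℝ (Fin n) → ℝ :=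
    fun x => A * q x + b * (s x * (s x - h / 2)) + a * s x - g x with hΦ
  have hΦcont : ContinuousOn Φ K := by
    refine ContinuousOn.sub ?_ (hgcont.mono hKball)
    fun_prop
  set z : EuclideanSpace ℝ (Fin n) := p + (h / 4) • ν with hz
  have hsz : s z = h / 4 := by
    simp only [hs, hz, add_sub_cancel_left, real_inner_smul_right, real_inner_self_eq_norm_sq, hν]
    ring
  have hqz : q z = 0 := by
    simp only [hq, hsz]
    simp only [hz, add_sub_cancel_left, norm_smul, hν, mul_one, Real.norm_eq_abs, sq_abs, sub_self]
  have hzK : z ∈ K := ⟨by rw [hqz]; positivity, by rw [hsz]; positivity, by rw [hsz]; linarith⟩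
  obtain ⟨x₀, hx₀, hmin⟩ := hKcomp.exists_isMinOn ⟨z, hzK⟩ hΦcont
  have hzneg : Φ z < 0 := by
    have := (hKest z hzK).1
    have h2 : 0 < b * h ^ 2 := by positivity
    simp only [hΦ, hqz, hsz] at this ⊢
    nlinarith
  have hneg : Φ x₀ < 0 := lt_of_le_of_lt (hmin hzK) hzneg
  obtain ⟨hge, hle⟩ := hKest x₀ hx₀
  obtain ⟨k1, k2, k3⟩ := hx₀
  have hq0 : 0 ≤ q x₀ := by
    simp only [hq, hs]
    have := abs_real_inner_le_norm ν (x₀ - p)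
    rw [hν, one_mul] at this
    have := sq_le_sq' (by linarith [neg_abs_le ⟪ν, x₀ - p⟫, norm_nonneg (x₀ - p)]) (le_trans (le_abs_self _) this)
    linarith
  have hAq : 0 ≤ A * q x₀ := by positivity
  have i1 : q x₀ < ρ ^ 2 := by
    refine lt_of_le_of_ne k1 fun he => ?_
    simp only [hΦ, he, hAρ] at hneg
    have h2 : ε * s x₀ ≤ ε * h := by gcongr
    have h3 : b * (s x₀ * (s x₀ - h / 2)) = b * (s x₀ - h / 4) ^ 2 - (b * h) * h / 16 := by ring
    have h4 : 0 ≤ b * (s x₀ - h / 4) ^ 2 := by positivity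
    rw [h3, hbh] at hneg
    have : 0 < ε * h := by positivity
    linarith
  have i2 : 0 < s x₀ := by
    refine lt_of_le_of_ne k2 fun he => ?_
    simp only [hΦ, ← he] at hneg hle
    linarith
  have i3 : s x₀ < h := by
    refine lt_of_le_of_ne k3 fun he => ?_
    simp only [hΦ, he] at hneg hle
    have : b * (h * (h - h / 2)) = (b * h) * h / 2 := by ring
    rw [this, hbh] at hneg
    linarith
  have hopen : IsOpen {x | q x < ρ ^ 2 ∧ 0 < s x ∧ s x < h} :=
    (isOpen_lt hqcont continuous_const).inter
      ((isOpen_lt continuous_const hscont).inter (isOpen_lt hscont continuous_const))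
  obtain ⟨δ, hδ, hδsub⟩ := Metric.isOpen_iff.1 hopen x₀ ⟨i1, i2, i3⟩
  have hδK : ball x₀ δ ⊆ K := fun x hx =>
    ⟨(hδsub hx).1.le, (hδsub hx).2.1.le, (hδsub hx).2.2.le⟩
  set L : EuclideanSpace ℝ (Fin n) →L[ℝ] ℝ := (a - b * (h / 2)) • innerSL ℝ ν + Lc with hL
  set d := ℓ 0 - (a - b * (h / 2)) * ⟪ν, p⟫ - Φ x₀ with hd
  set ψ : EuclideanSpace ℝ (Fin n) → ℝ :=
    fun y => A * ‖y - p‖ ^ 2 + (b - A) * ⟪ν, y - p⟫ ^ 2 + L y + d with hψ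
  have hψeq : ∀ y, ψ y = Φ y - Φ x₀ + u y := by
    intro y
    have hsy : s y = ⟪ν, y⟫ - ⟪ν, p⟫ := by simp only [hs, inner_sub_right]
    have e1 : ψ y = A * ‖y - p‖ ^ 2 + (b - A) * s y ^ 2 + ((a - b * (h / 2)) * ⟪ν, y⟫ + Lc y) + d := by
      simp [hψ, hL, hs]
    have e2 : Φ y = A * (‖y - p‖ ^ 2 - s y ^ 2) + b * (s y * (s y - h / 2)) + a * s y
        - (u y - (Lc y + ℓ 0)) := by
      simp only [hΦ, hq, hgdef, hdec y]
    have e3 : ⟪ν, y⟫ = s y + ⟪ν, p⟫ := by linarith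
    rw [e1, e2, hd, e3]
    ring
  have hfin := hu_sub x₀ (hKball (hδK (mem_ball_self hδ))) ψ δ hδ (hδK.trans hKball)
    (by
      apply ContDiff.contDiffOn
      have : ContDiff ℝ 2 fun y : EuclideanSpace ℝ (Fin n) => ‖y - p‖ ^ 2 :=
        (contDiff_id.sub contDiff_const).norm_sq ℝ
      have h2 : ContDiff ℝ 2 fun y : EuclideanSpace ℝ (Fin n) => ⟪ν, y - p⟫ :=
        contDiff_const.inner ℝ (contDiff_id.sub contDiff_const)
      exact (((contDiff_const.mul this).add (contDiff_const.mul (h2.pow 2))).add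
        L.contDiff).add contDiff_const)
    (fun y hy => by
      have : Φ x₀ ≤ Φ y := hmin (hδK hy)
      rw [hψeq]; linarith)
    (by rw [hψeq]; ring)
  rw [sigma2_quad ν hν A (b - A) _ (fun i j => hess_quad p ν A (b - A) d L x₀ i j)] at hfin
  exact absurd hfin (not_le.2 (barrier_numeric (n : ℝ) ρ h ε A b hn1 hρ0 (by linarith) hh
    (by linarith) hεdef hA hb))
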